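/- arXiv:2411.19163 — 2 statements merged into one kernel-verified Lean document; each statement's English description precedes it below -/
import Mathlib

section
/- Let m≥1, let d_1,…,d_m be positive integers with d=d_1+…+d_m, and let β=(β_1,…,β_m)∈[0,∞)^m. There is a constant C>0 depending only on (d_1,…,d_m) and β such that for every w=(v_1u_1,…,v_mu_m) with u_i∈S^{d_i−1} and v∈S_+^{m−1}, and every s∈(max{0,s_1(v)},‖v‖_1) with s_1(v)=‖v‖_1−2 min_i v_i, the Sylvester-type functional satisfies 0<C ≤ G(w,s) ≤ 1, where G(w,s)=E[Vol_{d−1}(conv{X̃_1,…,X̃_d})]/Vol_{d−1}(Z_𝕕∩H(w,s)) and X̃_1,…,X̃_d are i.i.d. random points on the hyperplane section Z_𝕕∩H(w,s) distributed with density proportional to the block-beta density x↦∏_{i=1}^m c_{β_i,d_i}(1−‖x^{(i)}‖_2^2)^{β_i} with respect to the (d−1)-dimensional Hausdorff measure on H(w,s). -/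
open MeasureTheory Filter
open scoped RealInnerProductSpace

noncomputable section

/-- Normalizing constant `c_{β,k}` of the beta density on the unit ball of `ℝ^k`
(note that `c_{β,0} = 1`). -/
def betaConst (β : ℝ) (k : ℕ) : ℝ :=
  Real.Gamma ((k : ℝ) / 2 + β + 1) / (Real.pi ^ ((k : ℝ) / 2) * Real.Gamma (β + 1))

/-- The Euclidean norm of the `i`-th block coordinate of
`x ∈ ℝ^d = ℝ^{d_1} × ⋯ × ℝ^{d_m}`. -/
def blockNorm {m : ℕ} (dv : Fin m → ℕ) (i : Fin m)
    (x : EuclideanSpace ℝ ((i : Fin m) × Fin (dv i))) : ℝ :=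
  Real.sqrt (∑ j : Fin (dv i), x ⟨i, j⟩ ^ 2)

/-- The product body `Z_𝕕 = B_2^{d_1} × ⋯ × B_2^{d_m} ⊂ ℝ^d`. -/
def prodOfBalls {m : ℕ} (dv : Fin m → ℕ) :
    Set (EuclideanSpace ℝ ((i : Fin m) × Fin (dv i))) :=
  {x | ∀ i, blockNorm dv i x ≤ 1}

/-- The Sylvester-type functional `G(w,s)`: the expected normalized
`(d−1)`-dimensional Hausdorff volume of the convex hull of `d` i.i.d. random points
in the hyperplane section `Z_𝕕 ∩ H(w,s)`, distributed with density proportional to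
the block-beta density with respect to the `(d−1)`-dimensional Hausdorff measure. -/
def sylvesterG {m : ℕ} (dv : Fin m → ℕ) (βv : Fin m → ℝ) (d : ℕ)
    (w : EuclideanSpace ℝ ((i : Fin m) × Fin (dv i))) (s : ℝ) : ℝ :=
  let sec : Set (EuclideanSpace ℝ ((i : Fin m) × Fin (dv i))) :=
    prodOfBalls dv ∩ {x | ⟪x, w⟫ = s}
  let ν : Measure (EuclideanSpace ℝ ((i : Fin m) × Fin (dv i))) :=
    ((μH[(d : ℝ) - 1]).restrict sec).withDensity fun x =>
      ENNReal.ofReal (∏ i, betaConst (βv i) (dv i) * (1 - blockNorm dv i x ^ 2) ^ (βv i))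
  (∫ y : Fin d → EuclideanSpace ℝ ((i : Fin m) × Fin (dv i)),
      (μH[(d : ℝ) - 1] (convexHull ℝ (Set.range y))).toReal
      ∂(Measure.pi fun _ : Fin d => (ν Set.univ)⁻¹ • ν)) /
    (μH[(d : ℝ) - 1] sec).toReal

open scoped ENNReal in
/-- The Sylvester functional of a body `S` for the density `f` with respect to a measure `μ`:
the expected normalized volume of the convex hull of `d` independent random points of `S`. -/
def sylvesterRatio {E : Type*} [AddCommGroup E] [Module ℝ E] [MeasurableSpace E]
    (μ : Measure E) (S : Set E) (f : E → ℝ≥0∞) (d : ℕ) : ℝ :=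
  (∫ y : Fin d → E, (μ (convexHull ℝ (Set.range y))).toReal
      ∂(Measure.pi fun _ : Fin d =>
        (((μ.restrict S).withDensity f) Set.univ)⁻¹ • ((μ.restrict S).withDensity f))) /
    (μ S).toReal

theorem measure_pi_mono {ι α : Type*} [Fintype ι] [MeasurableSpace α] {μ ν : Measure α}
    [SigmaFinite μ] (h : μ ≤ ν) :
    Measure.pi (fun _ : ι => μ) ≤ Measure.pi (fun _ : ι => ν) := by
  have key : (Measure.pi (fun _ : ι => μ)).toOuterMeasure ≤
      OuterMeasure.pi (fun _ : ι => ν.toOuterMeasure) := by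
    rw [OuterMeasure.le_pi]
    intro s _
    change Measure.pi (fun _ : ι => μ) _ ≤ _
    rw [Measure.pi_pi]
    exact Finset.prod_le_prod' fun i _ => h (s i)
  refine Measure.le_iff.2 fun s hs => (key s).trans (le_of_eq ?_)
  rw [Measure.pi_def, toMeasure_apply _ _ hs]

theorem isClosed_setOf_mem_convexHull_range {ι W : Type*} [Fintype ι] [NormedAddCommGroup W]
    [NormedSpace ℝ W] :
    IsClosed {p : (ι → W) × W | p.2 ∈ convexHull ℝ (Set.range p.1)} := by
  classical
  have h1 : ∀ y : ι → W, convexHull ℝ (Set.range y) =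
      (fun t : ι → ℝ => ∑ i, t i • y i) '' stdSimplex ℝ ι := by
    intro y
    rw [← convexHull_basis_eq_stdSimplex]
    have := (Fintype.linearCombination ℝ y).image_convexHull
      (Set.range fun i j : ι => if i = j then (1 : ℝ) else 0)
    rw [← Set.range_comp] at this
    convert this.symm using 2
    · ext x
      simp [Fintype.linearCombination_apply, Function.comp_def]
    · simp [Fintype.linearCombination_apply]
  have h2 : {p : (ι → W) × W | p.2 ∈ convexHull ℝ (Set.range p.1)} =
      Prod.snd '' {q : stdSimplex ℝ ι × ((ι → W) × W) | ∑ i, q.1.1 i • q.2.1 i = q.2.2} := by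
    ext ⟨y, x⟩
    simp only [Set.mem_ofPred_eq, h1, Set.mem_image, Prod.exists, Subtype.exists]
    constructor
    · rintro ⟨t, ht, rfl⟩
      exact ⟨t, ht, y, _, rfl, rfl⟩
    · rintro ⟨t, ht, y', x', h, h'⟩
      cases h'
      exact ⟨t, ht, h⟩
  rw [h2]
  have : CompactSpace (stdSimplex ℝ ι) := isCompact_iff_compactSpace.1 (isCompact_stdSimplex ℝ ι)
  refine isClosedMap_snd_of_compactSpace _ (isClosed_eq ?_ (by fun_prop))
  refine continuous_finsetSum _ fun i _ => ?_
  exact ((continuous_apply i).comp (continuous_subtype_val.comp continuous_fst)).smul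
    ((continuous_apply i).comp (continuous_fst.comp continuous_snd))

theorem measurable_measure_convexHull_range {ι W : Type*} [Fintype ι] [NormedAddCommGroup W]
    [NormedSpace ℝ W] [SecondCountableTopology W] [MeasurableSpace W] [BorelSpace W]
    (μ : Measure W) [SFinite μ] :
    Measurable fun y : ι → W => μ (convexHull ℝ (Set.range y)) :=
  measurable_measure_prodMk_left isClosed_setOf_mem_convexHull_range.measurableSet

theorem exists_affineIndependent_mem_of_isOpen {W : Type*} [NormedAddCommGroup W]
    [NormedSpace ℝ W] [FiniteDimensional ℝ W] {d : ℕ} (hd : Module.finrank ℝ W + 1 = d)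
    {A : Set W} (hA : IsOpen A) (hne : A.Nonempty) :
    ∃ y : Fin d → W, AffineIndependent ℝ y ∧ ∀ i, y i ∈ A := by
  obtain ⟨p, hp⟩ := hne
  obtain ⟨b⟩ : Nonempty (AffineBasis (Fin d) ℝ W) :=
    AffineBasis.exists_affineBasis_of_finiteDimensional (by simp [hd])
  have hev : ∀ᶠ t : ℝ in nhdsWithin 0 {0}ᶜ, ∀ i, AffineMap.homothety p t (b i) ∈ A := by
    refine eventually_all.2 fun i => Filter.Eventually.filter_mono nhdsWithin_le_nhds ?_
    have hc : Continuous fun t : ℝ => AffineMap.homothety p t (b i) := by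
      simp only [AffineMap.homothety_apply]
      fun_prop
    exact hc.continuousAt.eventually_mem (hA.mem_nhds (by simpa using hp))
  obtain ⟨t, ht, ht0⟩ := (hev.and self_mem_nhdsWithin).exists
  refine ⟨fun i => AffineMap.homothety p t (b i), ?_, ht⟩
  have hinj : Function.Injective (AffineMap.homothety p t : W →ᵃ[ℝ] W) := by
    intro x y h
    simpa [AffineMap.homothety_apply, Set.mem_compl_singleton_iff.1 ht0] using h
  exact b.ind.map' _ hinj

theorem lintegral_measure_convexHull_pos {W : Type*} [NormedAddCommGroup W]
    [NormedSpace ℝ W] [FiniteDimensional ℝ W] [MeasurableSpace W] [BorelSpace W]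
    {μ ρ : Measure W} [μ.IsOpenPosMeasure] [SFinite μ] [SigmaFinite ρ]
    {d : ℕ} (hd : Module.finrank ℝ W + 1 = d)
    {A : Set W} (hA : IsOpen A) (hne : A.Nonempty)
    (hρ : ∀ U ⊆ A, IsOpen U → U.Nonempty → ρ U ≠ 0) :
    0 < ∫⁻ y : Fin d → W, μ (convexHull ℝ (Set.range y)) ∂(Measure.pi fun _ => ρ) := by
  have : SecondCountableTopology W := secondCountable_of_proper
  obtain ⟨y, hy, hyA⟩ := exists_affineIndependent_mem_of_isOpen hd hA hne
  rw [lintegral_pos_iff_support (measurable_measure_convexHull_range μ)]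
  have hopen : IsOpen ({y : Fin d → W | AffineIndependent ℝ y} ∩ Set.univ.pi fun _ => A) :=
    isOpen_setOfPred_affineIndependent.inter (isOpen_set_pi Set.finite_univ fun _ _ => hA)
  obtain ⟨ε, hε, hball⟩ := Metric.isOpen_iff.1 hopen y ⟨hy, fun i _ => hyA i⟩
  rw [ball_pi _ hε] at hball
  refine lt_of_lt_of_le ?_ (measure_mono (hball.trans ?_))
  · rw [Measure.pi_pi]
    refine pos_iff_ne_zero.2 (Finset.prod_ne_zero_iff.2 fun i _ => ?_)
    refine hρ _ (fun x hx => ?_) Metric.isOpen_ball ⟨y i, Metric.mem_ball_self hε⟩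
    have := (@hball (Function.update y i x) (fun j _ => ?_)).2 i trivial
    · simpa using this
    · by_cases h : j = i
      · subst h; simpa using hx
      · simp [h, hε]
  · rintro z ⟨hz, -⟩
    have hint : (interior (convexHull ℝ (Set.range z))).Nonempty := by
      rw [interior_convexHull_nonempty_iff_affineSpan_eq_top]
      exact hz.affineSpan_eq_top_iff_card_eq_finrank_add_one.2 (by simp [hd])
    exact (Measure.measure_pos_of_nonempty_interior μ hint).ne'

open scoped ENNReal in
theorem inv_smul_self_smul_measure {E : Type*} [MeasurableSpace E] (ρ : Measure E) {k : ℝ≥0∞}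
    (hk0 : k ≠ 0) (hk : k ≠ ∞) :
    ((k • ρ) Set.univ)⁻¹ • (k • ρ) = (ρ Set.univ)⁻¹ • ρ := by
  rw [Measure.smul_apply, smul_eq_mul, ENNReal.mul_inv (Or.inl hk0) (Or.inl hk), smul_smul,
    mul_comm k⁻¹, mul_assoc, ENNReal.inv_mul_cancel hk0 hk, mul_one]

open scoped ENNReal in
theorem sylvesterRatio_smul_measure {E : Type*} [AddCommGroup E] [Module ℝ E] [MeasurableSpace E]
    (μ : Measure E) (S : Set E) (f : E → ℝ≥0∞) (d : ℕ) {k : ℝ≥0∞} (hk0 : k ≠ 0) (hk : k ≠ ∞) :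
    sylvesterRatio (k • μ) S f d = sylvesterRatio μ S f d := by
  have hk' : k.toReal ≠ 0 := ENNReal.toReal_ne_zero.2 ⟨hk0, hk⟩
  unfold sylvesterRatio
  rw [Measure.restrict_smul, withDensity_smul_measure, inv_smul_self_smul_measure _ hk0 hk]
  simp only [Measure.smul_apply, smul_eq_mul, ENNReal.toReal_mul, integral_const_mul]
  exact mul_div_mul_left _ _ hk'

open scoped ENNReal in
theorem sylvesterRatio_map {E W : Type*} [NormedAddCommGroup E] [NormedSpace ℝ E]
    [MeasurableSpace E] [BorelSpace E] [SecondCountableTopology E]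
    [NormedAddCommGroup W] [NormedSpace ℝ W]
    [MeasurableSpace W] [BorelSpace W] [FiniteDimensional ℝ W]
    (φ : W →ᵃ[ℝ] E) (hφ : Function.Injective φ) (hφc : Continuous φ)
    (μ : Measure E) (lam : Measure W) (hμ : ∀ s : Set W, μ (φ '' s) = lam s)
    {S : Set E} (hS : S ⊆ Set.range φ) {f : E → ℝ≥0∞} (hf : Measurable f) (d : ℕ)
    (hprob : IsProbabilityMeasure ((((lam.restrict (φ ⁻¹' S)).withDensity (f ∘ φ)) Set.univ)⁻¹ •
      ((lam.restrict (φ ⁻¹' S)).withDensity (f ∘ φ)))) :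
    sylvesterRatio μ S f d = sylvesterRatio lam (φ ⁻¹' S) (f ∘ φ) d := by
  have : ProperSpace W := FiniteDimensional.proper_real W
  have : SecondCountableTopology W := secondCountable_of_proper
  have hemb : MeasurableEmbedding φ := hφc.measurableEmbedding hφ
  have := Measure.isProbabilityMeasure_map (μ := ((((lam.restrict (φ ⁻¹' S)).withDensity (f ∘ φ))
    Set.univ)⁻¹ • ((lam.restrict (φ ⁻¹' S)).withDensity (f ∘ φ)))) hemb.measurable.aemeasurable
  have hres : μ.restrict S = (lam.restrict (φ ⁻¹' S)).map φ := by
    ext t ht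
    rw [hemb.map_apply, Measure.restrict_apply ht, Measure.restrict_apply (hemb.measurable ht),
      ← Set.preimage_inter, ← hμ, Set.image_preimage_eq_of_subset
        (Set.inter_subset_right.trans hS)]
  have hden : (μ.restrict S).withDensity f =
      ((lam.restrict (φ ⁻¹' S)).withDensity (f ∘ φ)).map φ := by
    ext t ht
    rw [hemb.map_apply, withDensity_apply _ ht, withDensity_apply _ (hemb.measurable ht), hres,
      hemb.restrict_map, lintegral_map hf hemb.measurable]
    rfl
  have huniv : (((lam.restrict (φ ⁻¹' S)).withDensity (f ∘ φ)).map φ) Set.univ =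
      ((lam.restrict (φ ⁻¹' S)).withDensity (f ∘ φ)) Set.univ := by
    rw [hemb.map_apply, Set.preimage_univ]
  have hpi : Function.Injective fun (y : Fin d → W) i => φ (y i) :=
    fun y z h => funext fun i => hφ (congrFun h i)
  have hpic : Continuous fun (y : Fin d → W) i => φ (y i) := by fun_prop
  unfold sylvesterRatio
  rw [hden, huniv, ← Measure.map_smul,
    ← Measure.pi_map_pi (fun _ => hemb.measurable.aemeasurable),
    (hpic.measurableEmbedding hpi).integral_map]
  congr 1
  · congr 1
    ext y
    rw [← hμ, AffineMap.image_convexHull, ← Set.range_comp]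
    rfl
  · rw [← hμ, Set.image_preimage_eq_of_subset hS]

open scoped ENNReal in
theorem sylvesterRatio_bounds {W : Type*} [NormedAddCommGroup W]
    [NormedSpace ℝ W] [FiniteDimensional ℝ W] [MeasurableSpace W] [BorelSpace W]
    (μ : Measure W) [μ.IsOpenPosMeasure] [IsFiniteMeasureOnCompacts μ]
    {d : ℕ} (hd : Module.finrank ℝ W + 1 = d) {A B : Set W} (hA : IsOpen A) (hne : A.Nonempty)
    (hB : Bornology.IsBounded B) {c M : ℝ≥0∞} (hc0 : c ≠ 0) (hc : c ≠ ∞) (hM0 : M ≠ 0)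
    (hM : M ≠ ∞) :
    ∃ C : ℝ, 0 < C ∧ ∀ (K : Set W) (f : W → ℝ≥0∞) (a : ℝ≥0∞), Convex ℝ K → MeasurableSet K →
      Measurable f → A ⊆ K → K ⊆ B → a ≠ 0 → a ≠ ∞ → (∀ x ∈ A, a * c ≤ f x) →
      (∀ x ∈ K, f x ≤ a * M) →
      IsProbabilityMeasure
        ((((μ.restrict K).withDensity f) Set.univ)⁻¹ • ((μ.restrict K).withDensity f)) ∧
      C ≤ sylvesterRatio μ K f d ∧ sylvesterRatio μ K f d ≤ 1 := by
  have : ProperSpace W := FiniteDimensional.proper_real W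
  have : SecondCountableTopology W := secondCountable_of_proper
  have hBtop : μ B ≠ ∞ := (hB.measure_lt_top).ne
  by_cases hAB : A ⊆ B
  swap
  · exact ⟨1, one_pos, fun K f a _ _ _ h1 h2 => absurd (h1.trans h2) hAB⟩
  have hA0 : μ A ≠ 0 := (hA.measure_pos μ hne).ne'
  have hB0 : μ B ≠ 0 := ((hA.measure_pos μ hne).trans_le (measure_mono hAB)).ne'
  have hAtop : μ A ≠ ∞ := measure_ne_top_of_subset hAB hBtop
  set κ : ℝ≥0∞ := c / (M * μ B) with hκ
  have hMB0 : M * μ B ≠ 0 := mul_ne_zero hM0 hB0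
  have hMBtop : M * μ B ≠ ∞ := ENNReal.mul_ne_top hM hBtop
  have hκ0 : κ ≠ 0 := ENNReal.div_ne_zero.2 ⟨hc0, hMBtop⟩
  have hκtop : κ ≠ ∞ := ENNReal.div_ne_top hc hMB0
  have : Fact (μ A < ∞) := ⟨hAtop.lt_top⟩
  have : IsFiniteMeasure (κ • μ.restrict A) := Measure.smul_finite _ hκtop
  set I : ℝ≥0∞ := ∫⁻ y : Fin d → W, μ (convexHull ℝ (Set.range y))
    ∂(Measure.pi fun _ => κ • μ.restrict A) with hI
  have hI0 : 0 < I := by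
    refine lintegral_measure_convexHull_pos hd hA hne fun U hU hUo hUne => ?_
    rw [Measure.smul_apply, Measure.restrict_apply hUo.measurableSet,
      Set.inter_eq_self_of_subset_left hU]
    exact mul_ne_zero hκ0 (hUo.measure_pos μ hUne).ne'
  set J : ℝ≥0∞ := min I (μ B) with hJ
  have hJ0 : J ≠ 0 := (lt_min hI0 (pos_iff_ne_zero.2 hB0)).ne'
  have hJtop : J ≠ ∞ := ((min_le_right _ _).trans_lt hBtop.lt_top).ne
  refine ⟨J.toReal / (μ B).toReal,
    div_pos (ENNReal.toReal_pos hJ0 hJtop) (ENNReal.toReal_pos hB0 hBtop), ?_⟩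
  intro K f a hKc hKm hf hAK hKB ha0 ha hfA hfK
  have hK0 : μ K ≠ 0 := ((hA.measure_pos μ hne).trans_le (measure_mono hAK)).ne'
  have hKtop : μ K ≠ ∞ := measure_ne_top_of_subset hKB hBtop
  set ν := (μ.restrict K).withDensity f with hν
  have hνle : ν Set.univ ≤ a * (M * μ B) := by
    rw [hν, withDensity_apply _ MeasurableSet.univ, Measure.restrict_univ]
    calc ∫⁻ x in K, f x ∂μ ≤ ∫⁻ _ in K, a * M ∂μ := setLIntegral_mono measurable_const hfK
      _ = a * M * μ K := by simp
      _ ≤ a * (M * μ B) := by rw [mul_assoc]; gcongr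
  have hνge : (a * c) • μ.restrict A ≤ ν := by
    refine Measure.le_iff.2 fun t ht => ?_
    rw [hν, withDensity_apply _ ht, Measure.restrict_restrict ht, Measure.smul_apply,
      Measure.restrict_apply ht, smul_eq_mul]
    calc a * c * μ (t ∩ A) = ∫⁻ _ in t ∩ A, a * c ∂μ := by simp
      _ ≤ ∫⁻ x in t ∩ A, f x ∂μ := setLIntegral_mono hf fun x hx => hfA x hx.2
      _ ≤ ∫⁻ x in t ∩ K, f x ∂μ :=
        lintegral_mono_set (Set.inter_subset_inter_right t hAK)
  have hνtop : ν Set.univ ≠ ∞ :=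
    (hνle.trans_lt (ENNReal.mul_lt_top ha.lt_top hMBtop.lt_top)).ne
  have hν0 : ν Set.univ ≠ 0 := by
    have h1 := hνge Set.univ
    rw [Measure.smul_apply, Measure.restrict_apply_univ, smul_eq_mul] at h1
    exact ((pos_iff_ne_zero.2 (mul_ne_zero (mul_ne_zero ha0 hc0) hA0)).trans_le h1).ne'
  have hprob : IsProbabilityMeasure ((ν Set.univ)⁻¹ • ν) :=
    ⟨by rw [Measure.smul_apply, smul_eq_mul, ENNReal.inv_mul_cancel hν0 hνtop]⟩
  refine ⟨hprob, ?_⟩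
  have hκle : κ • μ.restrict A ≤ (ν Set.univ)⁻¹ • ν := by
    have h1 : κ ≤ (ν Set.univ)⁻¹ * (a * c) := by
      calc κ = (a * (M * μ B))⁻¹ * (a * c) := by
            rw [hκ, ENNReal.mul_inv (Or.inl ha0) (Or.inl ha), mul_mul_mul_comm,
              ENNReal.inv_mul_cancel ha0 ha, one_mul, mul_comm, ENNReal.div_eq_inv_mul]
        _ ≤ _ := by gcongr
    refine Measure.le_iff.2 fun t ht => ?_
    calc (κ • μ.restrict A) t ≤ ((ν Set.univ)⁻¹ * (a * c)) * μ.restrict A t := by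
          rw [Measure.smul_apply, smul_eq_mul]; gcongr
      _ = (ν Set.univ)⁻¹ * ((a * c) • μ.restrict A) t := by
          rw [Measure.smul_apply, smul_eq_mul, mul_assoc]
      _ ≤ _ := by
          rw [Measure.smul_apply (ν Set.univ)⁻¹, smul_eq_mul]
          gcongr
  have hIle : I ≤ ∫⁻ y : Fin d → W, μ (convexHull ℝ (Set.range y))
      ∂(Measure.pi fun _ => (ν Set.univ)⁻¹ • ν) :=
    lintegral_mono' (measure_pi_mono hκle) le_rfl
  have hmemK : ∀ᵐ x ∂((ν Set.univ)⁻¹ • ν), x ∈ K :=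
    Measure.ae_smul_measure ((withDensity_absolutelyContinuous _ _).ae_le
      (ae_restrict_mem hKm)) _
  have hae : ∀ᵐ y ∂(Measure.pi fun _ : Fin d => (ν Set.univ)⁻¹ • ν),
      μ (convexHull ℝ (Set.range y)) ≤ μ K := by
    have h1 : ∀ i : Fin d, ∀ᵐ y ∂(Measure.pi fun _ : Fin d => (ν Set.univ)⁻¹ • ν), y i ∈ K :=
      fun i => (measurePreserving_eval (fun _ : Fin d => (ν Set.univ)⁻¹ • ν)
      i).quasiMeasurePreserving.ae hmemK
    filter_upwards [ae_all_iff.2 h1] with y hy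
    exact measure_mono (convexHull_min (Set.range_subset_iff.2 hy) hKc)
  have hleK : ∫⁻ y : Fin d → W, μ (convexHull ℝ (Set.range y))
      ∂(Measure.pi fun _ => (ν Set.univ)⁻¹ • ν) ≤ μ K := by
    calc _ ≤ ∫⁻ _, μ K ∂(Measure.pi fun _ : Fin d => (ν Set.univ)⁻¹ • ν) :=
          lintegral_mono_ae hae
      _ = μ K := by rw [lintegral_const, measure_univ, mul_one]
  have hval : sylvesterRatio μ K f d = (∫⁻ y : Fin d → W, μ (convexHull ℝ (Set.range y))
      ∂(Measure.pi fun _ => (ν Set.univ)⁻¹ • ν)).toReal / (μ K).toReal := by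
    unfold sylvesterRatio
    rw [integral_toReal (measurable_measure_convexHull_range μ).aemeasurable]
    filter_upwards [hae] with y hy
    exact hy.trans_lt hKtop.lt_top
  rw [hval]
  constructor
  · refine div_le_div₀ ENNReal.toReal_nonneg ?_ (ENNReal.toReal_pos hK0 hKtop)
      (ENNReal.toReal_mono hBtop (measure_mono hKB))
    exact ENNReal.toReal_mono (ne_top_of_le_ne_top hKtop hleK) ((min_le_left _ _).trans hIle)
  · exact div_le_one_of_le₀ (ENNReal.toReal_mono hKtop hleK) ENNReal.toReal_nonneg

/-- The `i`-th block coordinate, as a linear map. -/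
def blockProj {m : ℕ} (dv : Fin m → ℕ) (i : Fin m) :
    EuclideanSpace ℝ ((i : Fin m) × Fin (dv i)) →ₗ[ℝ] EuclideanSpace ℝ (Fin (dv i)) where
  toFun x := WithLp.toLp 2 fun j => x ⟨i, j⟩
  map_add' _ _ := rfl
  map_smul' _ _ := rfl

/-- The vector with prescribed block coordinates. -/
def ofBlocks {m : ℕ} (dv : Fin m → ℕ) :
    ((i : Fin m) → EuclideanSpace ℝ (Fin (dv i))) →ₗ[ℝ]
      EuclideanSpace ℝ ((i : Fin m) × Fin (dv i)) where
  toFun z := WithLp.toLp 2 fun p => z p.1 p.2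
  map_add' _ _ := rfl
  map_smul' _ _ := rfl

section Blocks

variable {m : ℕ} {dv : Fin m → ℕ}

theorem blockProj_apply (i : Fin m) (x : EuclideanSpace ℝ ((i : Fin m) × Fin (dv i)))
    (j : Fin (dv i)) : blockProj dv i x j = x ⟨i, j⟩ := rfl

theorem blockProj_ofBlocks (z : (i : Fin m) → EuclideanSpace ℝ (Fin (dv i))) (i : Fin m) :
    blockProj dv i (ofBlocks dv z) = z i := rfl

theorem continuous_blockProj (i : Fin m) : Continuous (blockProj dv i) :=
  LinearMap.continuous_of_finiteDimensional _

theorem blockNorm_eq_norm_blockProj (i : Fin m) (x : EuclideanSpace ℝ ((i : Fin m) × Fin (dv i))) :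
    blockNorm dv i x = ‖blockProj dv i x‖ := by
  simp [blockNorm, EuclideanSpace.norm_eq, blockProj_apply]

theorem continuous_blockNorm (i : Fin m) : Continuous (blockNorm dv i) := by
  simpa only [← blockNorm_eq_norm_blockProj] using (continuous_blockProj (dv := dv) i).norm

theorem inner_eq_sum_inner_blockProj (x y : EuclideanSpace ℝ ((i : Fin m) × Fin (dv i))) :
    ⟪x, y⟫ = ∑ i, ⟪blockProj dv i x, blockProj dv i y⟫ := by
  simp [PiLp.inner_apply, blockProj_apply, Fintype.sum_sigma]

theorem ext_blockProj {x y : EuclideanSpace ℝ ((i : Fin m) × Fin (dv i))}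
    (h : ∀ i, blockProj dv i x = blockProj dv i y) : x = y := by
  ext ⟨i, j⟩
  exact congrArg (fun z : EuclideanSpace ℝ (Fin (dv i)) => z j) (h i)

theorem norm_sq_eq_sum_norm_blockProj (x : EuclideanSpace ℝ ((i : Fin m) × Fin (dv i))) :
    ‖x‖ ^ 2 = ∑ i, ‖blockProj dv i x‖ ^ 2 := by
  simp only [← real_inner_self_eq_norm_sq, ← inner_eq_sum_inner_blockProj]

theorem convex_prodOfBalls : Convex ℝ (prodOfBalls dv) := by
  have : prodOfBalls dv = ⋂ i, blockProj dv i ⁻¹' Metric.closedBall 0 1 := by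
    ext x
    simp [prodOfBalls, blockNorm_eq_norm_blockProj]
  rw [this]
  exact convex_iInter fun i => (convex_closedBall _ _).linear_preimage _

theorem isClosed_prodOfBalls : IsClosed (prodOfBalls dv) := by
  simp only [prodOfBalls, Set.ofPred_forall]
  exact isClosed_iInter fun i => isClosed_le (continuous_blockNorm i) continuous_const

end Blocks

/-- The quantity `2τ - rτ² - (‖x‖² - τ²)` with `τ = ⟪e, x⟫`, which is nonnegative exactly on
the cap chart of the ball. -/
def capForm {F : Type*} [NormedAddCommGroup F] [InnerProductSpace ℝ F] (e : F) (r : ℝ) (x : F) :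
    ℝ :=
  2 * ⟪e, x⟫ - r * ⟪e, x⟫ ^ 2 - (‖x‖ ^ 2 - ⟪e, x⟫ ^ 2)

/-- The linear part of the chart of a cap of depth `r`: it scales the direction `e` by `-r` and
its orthogonal complement by `√r`. -/
def capMap {F : Type*} [NormedAddCommGroup F] [InnerProductSpace ℝ F] (e : F) (r : ℝ) :
    F →ₗ[ℝ] F :=
  Real.sqrt r • LinearMap.id - (Real.sqrt r + r) • (innerₛₗ ℝ e).smulRight e

section Cap

variable {F : Type*} [NormedAddCommGroup F] [InnerProductSpace ℝ F] {e : F} {r : ℝ}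

theorem capMap_apply (e : F) (r : ℝ) (x : F) :
    capMap e r x = Real.sqrt r • x - ((Real.sqrt r + r) * ⟪e, x⟫) • e := by
  simp [capMap, smul_smul]

theorem inner_capMap (he : ‖e‖ = 1) (x : F) : ⟪e, capMap e r x⟫ = -(r * ⟪e, x⟫) := by
  rw [capMap_apply, inner_sub_right, inner_smul_right, inner_smul_right,
    real_inner_self_eq_norm_sq, he]
  ring

theorem one_sub_norm_add_capMap_sq (he : ‖e‖ = 1) (hr : 0 ≤ r) (x : F) :
    1 - ‖e + capMap e r x‖ ^ 2 = r * capForm e r x := by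
  have h1 : ‖capMap e r x‖ ^ 2 = r * (‖x‖ ^ 2 - ⟪e, x⟫ ^ 2) + r ^ 2 * ⟪e, x⟫ ^ 2 := by
    rw [capMap_apply, norm_sub_sq_real, norm_smul, norm_smul, inner_smul_left, inner_smul_right,
      real_inner_comm e x, he, mul_pow, mul_pow, Real.norm_eq_abs, Real.norm_eq_abs, sq_abs, sq_abs]
    simp only [RCLike.conj_to_real]
    linear_combination (‖x‖ ^ 2 - ⟪e, x⟫ ^ 2) * Real.sq_sqrt hr
  rw [norm_add_sq_real, h1, inner_capMap he, he, capForm]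
  ring

theorem capMap_injective (he : ‖e‖ = 1) (hr : 0 < r) : Function.Injective (capMap e r) := by
  rw [injective_iff_map_eq_zero]
  intro x hx
  have h1 := inner_capMap (r := r) he x
  rw [hx, inner_zero_right] at h1
  have h2 : ⟪e, x⟫ = 0 := by
    rcases mul_eq_zero.1 (neg_eq_zero.1 h1.symm) with h | h
    · exact absurd h hr.ne'
    · exact h
  rw [capMap_apply, h2, mul_zero, zero_smul, sub_zero] at hx
  exact (smul_eq_zero.1 hx).resolve_left (Real.sqrt_pos.2 hr).ne'

theorem capForm_anti (e : F) {r R : ℝ} (h : r ≤ R) (x : F) : capForm e R x ≤ capForm e r x := by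
  unfold capForm
  nlinarith [mul_le_mul_of_nonneg_right h (sq_nonneg ⟪e, x⟫)]

theorem inner_sq_le_norm_sq (he : ‖e‖ = 1) (x : F) : ⟪e, x⟫ ^ 2 ≤ ‖x‖ ^ 2 := by
  have := abs_real_inner_le_norm e x
  rw [he, one_mul] at this
  exact sq_le_sq' (abs_le.1 this).1 (abs_le.1 this).2

theorem inner_nonneg_of_capForm_nonneg (he : ‖e‖ = 1) (hr : 0 ≤ r) {x : F}
    (h : 0 ≤ capForm e r x) : 0 ≤ ⟪e, x⟫ := by
  unfold capForm at h
  nlinarith [inner_sq_le_norm_sq he x, mul_nonneg hr (sq_nonneg ⟪e, x⟫)]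

theorem capForm_le_two (he : ‖e‖ = 1) (hr : 0 ≤ r) {x : F} (hx : ⟪e, x⟫ ≤ 1) :
    capForm e r x ≤ 2 := by
  unfold capForm
  nlinarith [inner_sq_le_norm_sq he x, mul_nonneg hr (sq_nonneg ⟪e, x⟫)]

theorem norm_le_two_of_capForm_nonneg (he : ‖e‖ = 1) (hr : 0 ≤ r) {x : F} (hx : ⟪e, x⟫ ≤ 1)
    (h : 0 ≤ capForm e r x) : ‖x‖ ≤ 2 := by
  have h0 := inner_nonneg_of_capForm_nonneg he hr h
  unfold capForm at h
  refine abs_le_of_sq_le_sq' ?_ zero_le_two |>.2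
  nlinarith [mul_nonneg hr (sq_nonneg ⟪e, x⟫)]

theorem exists_linearIsometryEquiv_apply_eq [CompleteSpace F] {e u : F} (h : ‖e‖ = ‖u‖) :
    ∃ R : F ≃ₗᵢ[ℝ] F, R e = u :=
  ⟨(ℝ ∙ (e - u))ᗮ.reflection, Submodule.reflection_sub h⟩

end Cap

open scoped ENNReal in
theorem exists_hausdorffMeasure_image_add_eq {U V : Type*} [NormedAddCommGroup U]
    [InnerProductSpace ℝ U] [FiniteDimensional ℝ U] [MeasurableSpace U] [BorelSpace U]
    [NormedAddCommGroup V] [InnerProductSpace ℝ V] [MeasurableSpace V] [BorelSpace V]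
    (L : U →ₗ[ℝ] V) (hL : Function.Injective L) (b : V) :
    ∃ k : ℝ≥0∞, k ≠ 0 ∧ k ≠ ∞ ∧ ∀ t : Set U,
      μH[Module.finrank ℝ U] ((fun x => b + L x) '' t) = k * μH[Module.finrank ℝ U] t := by
  refine ⟨ENNReal.ofReal L.normDet, ?_, ENNReal.ofReal_ne_top, fun t => ?_⟩
  · have h0 : L.normDet ≠ 0 := fun h =>
      LinearMap.normDet_eq_zero_iff_ker_ne_bot.1 h (LinearMap.ker_eq_bot.2 hL)
    exact (ENNReal.ofReal_pos.2 (lt_of_le_of_ne L.normDet_nonneg h0.symm)).ne'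
  · rw [← Set.image_image (fun z => b + z) L,
      (isometry_add_left b).hausdorffMeasure_image (Or.inl (Nat.cast_nonneg _)),
      LinearMap.hausdorffMeasure_image]

section Chart

variable {m : ℕ} {dv : Fin m → ℕ}

/-- The sum of the coordinates along the unit vectors `e i` of the blocks. -/
def blockHeight (e : (i : Fin m) → EuclideanSpace ℝ (Fin (dv i))) :
    EuclideanSpace ℝ ((i : Fin m) × Fin (dv i)) →ₗ[ℝ] ℝ :=
  ∑ i, innerₛₗ ℝ (e i) ∘ₗ blockProj dv i

/-- The point of height one all of whose block coordinates along `e i` equal `1 / m`. -/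
def blockCenter (e : (i : Fin m) → EuclideanSpace ℝ (Fin (dv i))) :
    EuclideanSpace ℝ ((i : Fin m) × Fin (dv i)) :=
  ofBlocks dv fun i => (1 / (m : ℝ)) • e i

variable {e : (i : Fin m) → EuclideanSpace ℝ (Fin (dv i))}

theorem blockHeight_apply (x : EuclideanSpace ℝ ((i : Fin m) × Fin (dv i))) :
    blockHeight e x = ∑ i, ⟪e i, blockProj dv i x⟫ := by
  simp [blockHeight]

theorem inner_blockProj_blockCenter (he : ∀ i, ‖e i‖ = 1) (i : Fin m) :
    ⟪e i, blockProj dv i (blockCenter e)⟫ = 1 / (m : ℝ) := by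
  rw [blockCenter, blockProj_ofBlocks, inner_smul_right, real_inner_self_eq_norm_sq, he]
  ring

theorem blockHeight_blockCenter (hm : 1 ≤ m) (he : ∀ i, ‖e i‖ = 1) :
    blockHeight e (blockCenter e) = 1 := by
  have : (m : ℝ) ≠ 0 := by positivity
  simp only [blockHeight_apply, inner_blockProj_blockCenter he]
  simp [this]

theorem finrank_ker_blockHeight (hm : 1 ≤ m) (he : ∀ i, ‖e i‖ = 1) :
    Module.finrank ℝ (LinearMap.ker (blockHeight e)) + 1 = ∑ i, dv i := by
  have h0 : blockHeight e ≠ 0 := fun h => by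
    have := blockHeight_blockCenter hm he
    rw [h] at this
    exact zero_ne_one this
  have := Module.Dual.finrank_ker_add_one_of_ne_zero h0
  rw [this, finrank_euclideanSpace, Fintype.card_sigma]
  simp

open scoped ENNReal in
theorem exists_chart (hm : 1 ≤ m) (he : ∀ i, ‖e i‖ = 1)
    {u : (i : Fin m) → EuclideanSpace ℝ (Fin (dv i))} (hu : ∀ i, ‖u i‖ = 1)
    {v r : Fin m → ℝ} (hr : ∀ i, 0 < r i) {δ : ℝ} (hδ : δ ≠ 0) (hvr : ∀ i, v i * r i = δ)
    {w : EuclideanSpace ℝ ((i : Fin m) × Fin (dv i))} (hw : ∀ i, blockProj dv i w = v i • u i) :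
    ∃ φ : LinearMap.ker (blockHeight e) →ᵃ[ℝ] EuclideanSpace ℝ ((i : Fin m) × Fin (dv i)),
      Function.Injective φ ∧ Set.range φ = {x | ⟪x, w⟫ = (∑ i, v i) - δ} ∧
      (∃ k : ℝ≥0∞, k ≠ 0 ∧ k ≠ ∞ ∧ ∀ t : Set (LinearMap.ker (blockHeight e)),
        μH[Module.finrank ℝ (LinearMap.ker (blockHeight e))] (φ '' t) =
          k * μH[Module.finrank ℝ (LinearMap.ker (blockHeight e))] t) ∧
      ∀ x i, 1 - ‖blockProj dv i (φ x)‖ ^ 2 =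
        r i * capForm (e i) (r i) (blockProj dv i (blockCenter e + x)) := by
  choose R hR using fun i => exists_linearIsometryEquiv_apply_eq ((he i).trans (hu i).symm)
  let L : EuclideanSpace ℝ ((i : Fin m) × Fin (dv i)) →ₗ[ℝ]
      EuclideanSpace ℝ ((i : Fin m) × Fin (dv i)) :=
    ofBlocks dv ∘ₗ LinearMap.pi fun i =>
      (R i).toLinearEquiv.toLinearMap ∘ₗ capMap (e i) (r i) ∘ₗ blockProj dv i
  have hL : ∀ x i, blockProj dv i (L x) = R i (capMap (e i) (r i) (blockProj dv i x)) :=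
    fun _ _ => rfl
  have hLinj : Function.Injective L := fun x y h => ext_blockProj fun i => by
    have := congrArg (blockProj dv i) h
    rw [hL, hL] at this
    exact capMap_injective (he i) (hr i) ((R i).injective this)
  have hLsurj : Function.Surjective L := LinearMap.injective_iff_surjective.1 hLinj
  have hblock : ∀ x i, blockProj dv i (ofBlocks dv u + L x) =
      R i (e i + capMap (e i) (r i) (blockProj dv i x)) := fun x i => by
    rw [map_add, map_add, hL, hR, blockProj_ofBlocks]
  have hinner : ∀ x, ⟪ofBlocks dv u + L x, w⟫ = (∑ i, v i) - δ * blockHeight e x := by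
    intro x
    rw [inner_eq_sum_inner_blockProj, blockHeight_apply, Finset.mul_sum, ← Finset.sum_sub_distrib]
    refine Finset.sum_congr rfl fun i _ => ?_
    rw [hblock, hw, ← hR, inner_smul_right, LinearIsometryEquiv.inner_map_map, real_inner_comm,
      inner_add_right, inner_capMap (he i), real_inner_self_eq_norm_sq, he, ← hvr i]
    ring
  let b := ofBlocks dv u + L (blockCenter e)
  let φ : LinearMap.ker (blockHeight e) →ᵃ[ℝ] EuclideanSpace ℝ ((i : Fin m) × Fin (dv i)) :=
    AffineMap.const ℝ _ b + (L ∘ₗ (LinearMap.ker (blockHeight e)).subtype).toAffineMap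
  have hφ' : ∀ x, φ x = b + (L ∘ₗ (LinearMap.ker (blockHeight e)).subtype) x := fun _ => rfl
  have hφ : ∀ x, φ x = ofBlocks dv u + L (blockCenter e + x) := fun x => by
    rw [hφ', map_add, ← add_assoc]
    rfl
  have hinj : Function.Injective (L ∘ₗ (LinearMap.ker (blockHeight e)).subtype) :=
    hLinj.comp Subtype.val_injective
  refine ⟨φ, ?_, ?_, ?_, ?_⟩
  · intro x y h
    rw [hφ', hφ'] at h
    exact hinj (add_left_cancel h)
  · ext z
    constructor
    · rintro ⟨x, rfl⟩
      rw [Set.mem_ofPred_eq, hφ, hinner, map_add, blockHeight_blockCenter hm he,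
        LinearMap.mem_ker.1 x.2]
      ring
    · intro hz
      obtain ⟨y, hy⟩ := hLsurj (z - ofBlocks dv u)
      have hzy : z = ofBlocks dv u + L y := by rw [hy]; abel
      rw [Set.mem_ofPred_eq, hzy, hinner] at hz
      have h1 : blockHeight e y = 1 := by
        have : δ * blockHeight e y = δ * 1 := by linarith
        exact mul_left_cancel₀ hδ this
      refine ⟨⟨y - blockCenter e, ?_⟩, ?_⟩
      · rw [LinearMap.mem_ker, map_sub, h1, blockHeight_blockCenter hm he, sub_self]
      · rw [hφ, hzy]
        simp
  · exact exists_hausdorffMeasure_image_add_eq _ hinj b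
  · intro x i
    rw [hφ, hblock, LinearIsometryEquiv.norm_map, one_sub_norm_add_capMap_sq (he i) (hr i).le]

end Chart

theorem betaConst_pos {β : ℝ} (hβ : 0 ≤ β) (k : ℕ) : 0 < betaConst β k :=
  div_pos (Real.Gamma_pos_of_pos (by positivity))
    (mul_pos (Real.rpow_pos_of_pos Real.pi_pos _) (Real.Gamma_pos_of_pos (by positivity)))

theorem exists_capDepth_bound {m : ℕ} (hm : 1 ≤ m) :
    ∃ D : ℝ, 0 < 2 / (m : ℝ) - D * (1 / (m : ℝ)) ^ 2 ∧
      ∀ (v : Fin m → ℝ) (δ : ℝ), (∀ i, 0 < v i) → (∀ i, δ < 2 * v i) → δ < ∑ i, v i →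
        ∀ i, δ / v i ≤ D := by
  rcases hm.eq_or_lt with rfl | hm2
  · refine ⟨1, by norm_num, fun v δ hv _ hδ i => ?_⟩
    rw [div_le_one (hv i), Subsingleton.elim i 0]
    simpa using hδ.le
  · refine ⟨2, ?_, fun v δ hv h2 _ i => ?_⟩
    · have h : (1 : ℝ) < m := by exact_mod_cast hm2
      have h0 : (0 : ℝ) < m := by linarith
      have : 2 / (m : ℝ) - 2 * (1 / (m : ℝ)) ^ 2 = 2 * (m - 1) / (m : ℝ) ^ 2 := by field_simp
      rw [this]
      have : (0 : ℝ) < m - 1 := by linarith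
      positivity
    · rw [div_le_iff₀ (hv i)]
      exact (h2 i).le

section Uniform

variable {m : ℕ} {dv : Fin m → ℕ} {e : (i : Fin m) → EuclideanSpace ℝ (Fin (dv i))}

theorem capForm_blockCenter (he : ∀ i, ‖e i‖ = 1) (D : ℝ) (i : Fin m) :
    capForm (e i) D (blockProj dv i (blockCenter e)) =
      2 / (m : ℝ) - D * (1 / (m : ℝ)) ^ 2 := by
  rw [capForm, inner_blockProj_blockCenter he, blockCenter, blockProj_ofBlocks, norm_smul, he]
  simp
  ring

theorem continuous_capForm_blockProj (D : ℝ) (i : Fin m) :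
    Continuous fun x : LinearMap.ker (blockHeight e) =>
      capForm (e i) D (blockProj dv i (blockCenter e + x)) := by
  have : Continuous fun x : LinearMap.ker (blockHeight e) =>
      blockProj dv i (blockCenter e + x) :=
    (continuous_blockProj i).comp (continuous_const.add continuous_subtype_val)
  unfold capForm
  fun_prop

theorem isOpen_setOf_lt_capForm (D η : ℝ) :
    IsOpen {x : LinearMap.ker (blockHeight e) |
      ∀ i, η < capForm (e i) D (blockProj dv i (blockCenter e + x))} := by
  simp only [Set.ofPred_forall]
  exact isOpen_iInter_of_finite fun i =>
    isOpen_lt continuous_const (continuous_capForm_blockProj D i)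

theorem isBounded_setOf_norm_blockProj_le (ρ : ℝ) :
    Bornology.IsBounded {x : LinearMap.ker (blockHeight e) |
      ∀ i, ‖blockProj dv i (blockCenter e + x)‖ ≤ ρ} := by
  refine (Metric.isBounded_closedBall (x := (0 : LinearMap.ker (blockHeight e)))
    (r := Real.sqrt (∑ _ : Fin m, ρ ^ 2) + ‖blockCenter e‖)).subset fun x hx => ?_
  rw [mem_closedBall_zero_iff, Submodule.coe_norm]
  have h1 : ‖blockCenter e + (x : EuclideanSpace ℝ ((i : Fin m) × Fin (dv i)))‖ ≤
      Real.sqrt (∑ _ : Fin m, ρ ^ 2) := by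
    refine Real.le_sqrt_of_sq_le ?_
    rw [norm_sq_eq_sum_norm_blockProj]
    exact Finset.sum_le_sum fun i _ => pow_le_pow_left₀ (norm_nonneg _) (hx i) 2
  have h2 := norm_sub_le (blockCenter e + (x : EuclideanSpace ℝ ((i : Fin m) × Fin (dv i))))
    (blockCenter e)
  rw [add_sub_cancel_left] at h2
  linarith

theorem inner_blockProj_le_one (hm : 1 ≤ m) (he : ∀ i, ‖e i‖ = 1)
    (x : LinearMap.ker (blockHeight e))
    (h : ∀ i, 0 ≤ ⟪e i, blockProj dv i (blockCenter e + x)⟫) (i : Fin m) :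
    ⟪e i, blockProj dv i (blockCenter e + x)⟫ ≤ 1 := by
  have h1 : ∑ i, ⟪e i, blockProj dv i (blockCenter e + x)⟫ = 1 := by
    rw [← blockHeight_apply, map_add, blockHeight_blockCenter hm he, LinearMap.mem_ker.1 x.2,
      add_zero]
  rw [← h1]
  exact Finset.single_le_sum (f := fun i => ⟪e i, blockProj dv i (blockCenter e + x)⟫)
    (fun j _ => h j) (Finset.mem_univ i)

theorem prod_mul_rpow {β : Fin m → ℝ} {c r t : Fin m → ℝ} (hr : ∀ i, 0 ≤ r i) (ht : ∀ i, 0 ≤ t i) :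
    ∏ i, c i * (r i * t i) ^ β i = (∏ i, c i * r i ^ β i) * ∏ i, t i ^ β i := by
  rw [← Finset.prod_mul_distrib]
  exact Finset.prod_congr rfl fun i _ => by rw [Real.mul_rpow (hr i) (ht i), mul_assoc]

open scoped ENNReal in
theorem exists_sylvesterRatio_chart_bounds (hm : 1 ≤ m) {βv : Fin m → ℝ} (hβ : ∀ i, 0 ≤ βv i)
    (he : ∀ i, ‖e i‖ = 1) {d : ℕ} (hsum : ∑ i, dv i = d)
    {D : ℝ} (hD : 0 < 2 / (m : ℝ) - D * (1 / (m : ℝ)) ^ 2) :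
    ∃ C : ℝ, 0 < C ∧ ∀ (φ : LinearMap.ker (blockHeight e) →ᵃ[ℝ]
        EuclideanSpace ℝ ((i : Fin m) × Fin (dv i))) (r : Fin m → ℝ) (k : ℝ≥0∞)
        (S : Set (EuclideanSpace ℝ ((i : Fin m) × Fin (dv i)))),
      (∀ i, 0 < r i) → (∀ i, r i ≤ D) → k ≠ 0 → k ≠ ∞ → Function.Injective φ →
      S = prodOfBalls dv ∩ Set.range φ →
      (∀ t : Set (LinearMap.ker (blockHeight e)),
        μH[(d : ℝ) - 1] (φ '' t) =
          k * μH[Module.finrank ℝ (LinearMap.ker (blockHeight e))] t) →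
      (∀ x i, 1 - ‖blockProj dv i (φ x)‖ ^ 2 =
        r i * capForm (e i) (r i) (blockProj dv i (blockCenter e + x))) →
      C ≤ sylvesterRatio μH[(d : ℝ) - 1] S (fun x => ENNReal.ofReal
        (∏ i, betaConst (βv i) (dv i) * (1 - blockNorm dv i x ^ 2) ^ (βv i))) d ∧
      sylvesterRatio μH[(d : ℝ) - 1] S (fun x => ENNReal.ofReal
        (∏ i, betaConst (βv i) (dv i) * (1 - blockNorm dv i x ^ 2) ^ (βv i))) d ≤ 1 := by
  obtain ⟨η, hη0, hη⟩ := exists_between hD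
  have hc : 0 < ∏ i, η ^ βv i := Finset.prod_pos fun i _ => Real.rpow_pos_of_pos hη0 _
  have hM : (0 : ℝ) < ∏ i, (2 : ℝ) ^ βv i :=
    Finset.prod_pos fun i _ => Real.rpow_pos_of_pos two_pos _
  obtain ⟨C, hC, hCb⟩ := sylvesterRatio_bounds
    (μH[Module.finrank ℝ (LinearMap.ker (blockHeight e))])
    ((finrank_ker_blockHeight hm he).trans hsum)
    (isOpen_setOf_lt_capForm (e := e) D η)
    ⟨0, fun i => by simpa [capForm_blockCenter he] using hη⟩
    (isBounded_setOf_norm_blockProj_le (e := e) 2)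
    (ENNReal.ofReal_pos.2 hc).ne' ENNReal.ofReal_ne_top
    (ENNReal.ofReal_pos.2 hM).ne' ENNReal.ofReal_ne_top
  refine ⟨C, hC, fun φ r k S hr hrD hk0 hk hφ hS hφμ hφn => ?_⟩
  set f : EuclideanSpace ℝ ((i : Fin m) × Fin (dv i)) → ℝ≥0∞ := fun x => ENNReal.ofReal
    (∏ i, betaConst (βv i) (dv i) * (1 - blockNorm dv i x ^ 2) ^ (βv i)) with hf
  have hfm : Measurable f := by
    refine ENNReal.measurable_ofReal.comp (Finset.measurable_fun_prod _ fun i _ => ?_)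
    have := (continuous_blockNorm (dv := dv) i).measurable
    fun_prop
  have hφc : Continuous φ := φ.continuous_of_finiteDimensional
  have hmemK : ∀ x, x ∈ φ ⁻¹' S ↔
      ∀ i, 0 ≤ capForm (e i) (r i) (blockProj dv i (blockCenter e + x)) := by
    intro x
    rw [hS, Set.mem_preimage, Set.mem_inter_iff, and_iff_left (Set.mem_range_self x)]
    refine forall_congr' fun i => ?_
    rw [blockNorm_eq_norm_blockProj, ← mul_nonneg_iff_of_pos_left (hr i), ← hφn, sub_nonneg,
      sq_le_one_iff₀ (norm_nonneg _)]
  have hKeq : φ ⁻¹' S = φ ⁻¹' prodOfBalls dv := by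
    rw [hS, Set.preimage_inter, Set.preimage_range, Set.inter_univ]
  have hKconv : Convex ℝ (φ ⁻¹' S) := hKeq ▸ convex_prodOfBalls.affine_preimage φ
  have hKm : MeasurableSet (φ ⁻¹' S) :=
    hKeq ▸ (isClosed_prodOfBalls.preimage hφc).measurableSet
  have hle1 : ∀ x ∈ φ ⁻¹' S, ∀ i, ⟪e i, blockProj dv i (blockCenter e + x)⟫ ≤ 1 :=
    fun x hx => inner_blockProj_le_one hm he x fun i =>
      inner_nonneg_of_capForm_nonneg (he i) (hr i).le ((hmemK x).1 hx i)
  have hlow : ∀ x, (∀ i, η < capForm (e i) D (blockProj dv i (blockCenter e + x))) →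
      ∀ i, η ≤ capForm (e i) (r i) (blockProj dv i (blockCenter e + x)) :=
    fun x hx i => (hx i).le.trans (capForm_anti _ (hrD i) _)
  set a : ℝ := ∏ i, betaConst (βv i) (dv i) * r i ^ βv i with ha
  have ha0 : 0 < a := Finset.prod_pos fun i _ =>
    mul_pos (betaConst_pos (hβ i) _) (Real.rpow_pos_of_pos (hr i) _)
  have hfφ : ∀ x ∈ φ ⁻¹' S, (f ∘ φ) x = ENNReal.ofReal
      (a * ∏ i, capForm (e i) (r i) (blockProj dv i (blockCenter e + x)) ^ βv i) := by
    intro x hx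
    rw [ha, ← prod_mul_rpow (fun i => (hr i).le) ((hmemK x).1 hx)]
    simp only [hf, Function.comp_apply, blockNorm_eq_norm_blockProj, hφn]
  obtain ⟨hprob, hlo, hhi⟩ := hCb (φ ⁻¹' S) (f ∘ φ) (ENNReal.ofReal a) hKconv hKm
    (hfm.comp hφc.measurable)
    (fun x hx => (hmemK x).2 fun i => hη0.le.trans (hlow x hx i))
    (fun x hx i => norm_le_two_of_capForm_nonneg (he i) (hr i).le (hle1 x hx i)
      ((hmemK x).1 hx i))
    (ENNReal.ofReal_pos.2 ha0).ne' ENNReal.ofReal_ne_top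
    (fun x hx => by
      rw [hfφ x ((hmemK x).2 fun i => hη0.le.trans (hlow x hx i)), ← ENNReal.ofReal_mul ha0.le]
      refine ENNReal.ofReal_le_ofReal (mul_le_mul_of_nonneg_left ?_ ha0.le)
      exact Finset.prod_le_prod (fun i _ => Real.rpow_nonneg hη0.le _) fun i _ =>
        Real.rpow_le_rpow hη0.le (hlow x hx i) (hβ i))
    (fun x hx => by
      rw [hfφ x hx, ← ENNReal.ofReal_mul ha0.le]
      refine ENNReal.ofReal_le_ofReal (mul_le_mul_of_nonneg_left ?_ ha0.le)
      exact Finset.prod_le_prod (fun i _ => Real.rpow_nonneg ((hmemK x).1 hx i) _) fun i _ =>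
        Real.rpow_le_rpow ((hmemK x).1 hx i)
          (capForm_le_two (he i) (hr i).le (hle1 x hx i)) (hβ i))
  have hkey : sylvesterRatio μH[(d : ℝ) - 1] S f d = sylvesterRatio
      (μH[Module.finrank ℝ (LinearMap.ker (blockHeight e))]) (φ ⁻¹' S) (f ∘ φ) d := by
    rw [← sylvesterRatio_smul_measure (E := LinearMap.ker (blockHeight e)) _ _ _ _ hk0 hk]
    refine sylvesterRatio_map φ hφ hφc _ _ (fun t => ?_) (hS ▸ Set.inter_subset_right) hfm d ?_
    · rw [hφμ, Measure.smul_apply, smul_eq_mul]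
    · rw [Measure.restrict_smul, withDensity_smul_measure, inv_smul_self_smul_measure _ hk0 hk]
      exact hprob
  rw [hkey]
  exact ⟨hlo, hhi⟩

end Uniform

/-- **Lemma 3.5**: the Sylvester-type functional is bounded above by `1` and below by
a strictly positive constant depending only on the model parameters, uniformly over all
`w = (v_1u_1,…,v_mu_m)` with `v ∈ S_+^{m−1}` and all `s ∈ (max{0,s_1(v)}, ‖v‖_1)`. -/
theorem sylvesterG_bounded
    (d m : ℕ) (hm : 1 ≤ m)
    (dv : Fin m → ℕ) (hdv : ∀ i, 1 ≤ dv i) (hsum : ∑ i, dv i = d)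
    (βv : Fin m → ℝ) (hβ : ∀ i, 0 ≤ βv i) :
    ∃ C : ℝ, 0 < C ∧
      ∀ (w : EuclideanSpace ℝ ((i : Fin m) × Fin (dv i)))
        (u : Π i, EuclideanSpace ℝ (Fin (dv i)))
        (v : EuclideanSpace ℝ (Fin m)) (s : ℝ),
        (∀ i, ‖u i‖ = 1) → ‖v‖ = 1 → (∀ i, 0 ≤ v i) →
        (∀ p : (i : Fin m) × Fin (dv i), w p = v p.1 * u p.1 p.2) →
        max 0 ((∑ i, v i) -
            2 * Finset.univ.inf' ⟨⟨0, hm⟩, Finset.mem_univ _⟩ (fun i => v i)) < s →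
        s < ∑ i, v i →
        C ≤ sylvesterG dv βv d w s ∧ sylvesterG dv βv d w s ≤ 1 := by
  obtain ⟨D, hD, hDb⟩ := exists_capDepth_bound hm
  let e : (i : Fin m) → EuclideanSpace ℝ (Fin (dv i)) :=
    fun i => EuclideanSpace.single ⟨0, hdv i⟩ 1
  have he : ∀ i, ‖e i‖ = 1 := fun i => by simp [e]
  obtain ⟨C, hC, hCb⟩ := exists_sylvesterRatio_chart_bounds hm hβ he hsum hD
  refine ⟨C, hC, fun w u v s hu _ hv0 hw hs1 hs2 => ?_⟩
  set vmin := Finset.univ.inf' ⟨⟨0, hm⟩, Finset.mem_univ _⟩ (fun i => v i)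
  obtain ⟨hs0, hs1⟩ := max_lt_iff.1 hs1
  have hmin : ∀ i, vmin ≤ v i := fun i => Finset.inf'_le _ (Finset.mem_univ i)
  have hv : ∀ i, 0 < v i := fun i => by linarith [hmin i]
  set δ := (∑ i, v i) - s with hδ
  have hδ0 : 0 < δ := by linarith
  have hr : ∀ i, 0 < δ / v i := fun i => div_pos hδ0 (hv i)
  obtain ⟨φ, hφ, hrange, ⟨k, hk0, hk, hφμ⟩, hφn⟩ := exists_chart hm he hu hr hδ0.ne'
    (fun i => mul_div_cancel₀ δ (hv i).ne') (w := w) (fun i => by ext j; exact hw ⟨i, j⟩)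
  refine hCb φ _ k _ hr
    (hDb _ δ hv (fun i => by linarith [hmin i]) (by linarith)) hk0 hk hφ ?_ ?_ hφn
  · rw [hrange, hδ, sub_sub_cancel]
  · have hfin : (d : ℝ) - 1 = Module.finrank ℝ (LinearMap.ker (blockHeight e)) := by
      rw [← hsum, ← finrank_ker_blockHeight hm he]
      push_cast
      ring
    rw [hfin]
    exact hφμ
end
end

section
/- Let m≥1 and let d_1,…,d_m be positive integers with d=d_1+…+d_m, d≥2. Let w=(v_1u_1,…,v_mu_m) with u_i∈S^{d_i−1} and v∈S_+^{m−1}, let s∈(max{0,s_1(v)},‖v‖_1) where s_1(v)=‖v‖_1−2 min_i v_i, and set ε_i=(‖v‖_1−s)/(2m v_i) for i∈{1,…,m} and Z_𝕕(ε)={(x^{(1)},…,x^{(m)}) : ‖x^{(i)}‖_2 ≤ 1−ε_i for all i}. Then there is a constant C>0 depending only on (d_1,…,d_m) such that Vol_{d−1}(Z_𝕕(ε) ∩ H(w,s)) ≥ C·(‖v‖_1−s)^{(d+m)/2−1}·∏_{i=1}^m v_i^{−(d_i+1)/2}. -/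
open MeasureTheory Filter
open scoped RealInnerProductSpace

noncomputable section

/-- The shrunken product body
`Z_𝕕(ε) = {x : ‖x^{(i)}‖_2 ≤ 1 − ε_i for all i}`. -/
def shrunkenProdOfBalls {m : ℕ} (dv : Fin m → ℕ) (ε : Fin m → ℝ) :
    Set (EuclideanSpace ℝ ((i : Fin m) × Fin (dv i))) :=
  {x | ∀ i, blockNorm dv i x ≤ 1 - ε i}

/-- The `i`-th block coordinate `x^{(i)}` of `x`. -/
def block {m : ℕ} (dv : Fin m → ℕ) (i : Fin m)
    (x : EuclideanSpace ℝ ((i : Fin m) × Fin (dv i))) : EuclideanSpace ℝ (Fin (dv i)) :=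
  WithLp.toLp 2 fun j => x ⟨i, j⟩

lemma blockNorm_eq_norm_block {m : ℕ} (dv : Fin m → ℕ) (i : Fin m)
    (x : EuclideanSpace ℝ ((i : Fin m) × Fin (dv i))) :
    blockNorm dv i x = ‖block dv i x‖ := by
  simp [blockNorm, block, EuclideanSpace.norm_eq]

lemma block_sub {m : ℕ} (dv : Fin m → ℕ) (i : Fin m)
    (x y : EuclideanSpace ℝ ((i : Fin m) × Fin (dv i))) :
    block dv i (x - y) = block dv i x - block dv i y := by
  ext j; simp [block]

lemma norm_block_le {m : ℕ} (dv : Fin m → ℕ) (i : Fin m)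
    (x : EuclideanSpace ℝ ((i : Fin m) × Fin (dv i))) : ‖block dv i x‖ ≤ ‖x‖ := by
  rw [EuclideanSpace.norm_eq, EuclideanSpace.norm_eq, Fintype.sum_sigma]
  exact Real.sqrt_le_sqrt (Finset.single_le_sum
    (f := fun i => ∑ j : Fin (dv i), ‖x ⟨i, j⟩‖ ^ 2)
    (fun _ _ => Finset.sum_nonneg fun _ _ => sq_nonneg _) (Finset.mem_univ i))

lemma inner_eq_sum_inner_block {m : ℕ} (dv : Fin m → ℕ)
    (x w : EuclideanSpace ℝ ((i : Fin m) × Fin (dv i)))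
    (u : Π i, EuclideanSpace ℝ (Fin (dv i))) (v : Fin m → ℝ)
    (hw : ∀ p : (i : Fin m) × Fin (dv i), w p = v p.1 * u p.1 p.2) :
    ⟪x, w⟫ = ∑ i, v i * ⟪u i, block dv i x⟫ := by
  simp only [PiLp.inner_apply, Fintype.sum_sigma, hw, block, Finset.mul_sum]
  refine Finset.sum_congr rfl fun i _ => Finset.sum_congr rfl fun j _ => ?_
  simp
  ring

/-- A unit vector of `ℝ^n` is the first vector of some orthonormal basis. -/
lemma exists_orthonormalBasis_zero_eq {n : ℕ} (hn : 0 < n) (u : EuclideanSpace ℝ (Fin n))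
    (hu : ‖u‖ = 1) :
    ∃ b : OrthonormalBasis (Fin n) ℝ (EuclideanSpace ℝ (Fin n)), b ⟨0, hn⟩ = u := by
  have h : Orthonormal ℝ (({⟨0, hn⟩} : Set (Fin n)).domRestrict fun _ => u) := by
    rw [orthonormal_iff_ite]
    intro i j
    simp [Subsingleton.elim i j, Set.domRestrict, hu]
  obtain ⟨b, hb⟩ := h.exists_orthonormalBasis_extension_of_card_eq (by simp)
  exact ⟨b, hb _ rfl⟩

/-- A set whose image in coordinates with respect to orthonormal bases of the blocks, with one
coordinate dropped, contains a coordinate box, has Hausdorff measure at least the volume of that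
box. -/
lemma ofReal_prod_le_hausdorffMeasure {m : ℕ} (dv : Fin m → ℕ)
    (b : ∀ i, OrthonormalBasis (Fin (dv i)) ℝ (EuclideanSpace ℝ (Fin (dv i))))
    (q₀ : (i : Fin m) × Fin (dv i))
    (z r : (i : Fin m) × Fin (dv i) → ℝ) (hr : ∀ q, 0 ≤ r q)
    (S : Set (EuclideanSpace ℝ ((i : Fin m) × Fin (dv i))))
    (hS : ∀ c : {q // q ≠ q₀} → ℝ, (∀ q, |c q - z q| ≤ r q) →
      ∃ x ∈ S, ∀ q : {q // q ≠ q₀}, ⟪b q.1.1 q.1.2, block dv q.1.1 x⟫ = c q) :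
    ENNReal.ofReal (∏ q : {q // q ≠ q₀}, 2 * r q) ≤
      μH[((∑ i, dv i : ℕ) : ℝ) - 1] S := by
  let f : EuclideanSpace ℝ ((i : Fin m) × Fin (dv i)) → ({q // q ≠ q₀} → ℝ) :=
    fun x q => ⟪b q.1.1 q.1.2, block dv q.1.1 x⟫
  have hf : LipschitzWith 1 f := by
    refine LipschitzWith.of_dist_le_mul fun x y => ?_
    rw [NNReal.coe_one, one_mul]
    refine (dist_pi_le_iff dist_nonneg).2 fun q => ?_
    rw [Real.dist_eq, dist_eq_norm, ← inner_sub_right, ← block_sub]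
    refine (abs_real_inner_le_norm _ _).trans ?_
    rw [(b q.1.1).orthonormal.1, one_mul]
    exact norm_block_le ..
  have hcard : (Fintype.card {q // q ≠ q₀} : ℝ) = ((∑ i, dv i : ℕ) : ℝ) - 1 := by
    have hpos : 0 < Fintype.card ((i : Fin m) × Fin (dv i)) := Fintype.card_pos_iff.2 ⟨q₀⟩
    have h : Fintype.card {q // q ≠ q₀} = ∑ i, dv i - 1 := by
      rw [Fintype.card_subtype_compl, Fintype.card_subtype_eq]
      simp
    rw [h, Nat.cast_sub (Nat.succ_le_of_lt (by simpa using hpos)), Nat.cast_one]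
  have hsub : Set.Icc (fun q : {q // q ≠ q₀} => z q - r q) (fun q => z q + r q) ⊆ f '' S := by
    intro c hc
    obtain ⟨x, hx, hxc⟩ := hS c fun q => abs_le.2
      ⟨by linarith [hc.1 q], by linarith [hc.2 q]⟩
    exact ⟨x, hx, funext hxc⟩
  have hnonneg : (0 : ℝ) ≤ ((∑ i, dv i : ℕ) : ℝ) - 1 := hcard ▸ Nat.cast_nonneg _
  calc ENNReal.ofReal (∏ q : {q // q ≠ q₀}, 2 * r q)
      = volume (Set.Icc (fun q : {q // q ≠ q₀} => z q - r q) (fun q => z q + r q)) := by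
        rw [Real.volume_Icc_pi, ENNReal.ofReal_prod_of_nonneg fun q _ => by linarith [hr q.1]]
        exact Finset.prod_congr rfl fun q _ => by congr 1; ring
    _ ≤ volume (f '' S) := measure_mono hsub
    _ = μH[((∑ i, dv i : ℕ) : ℝ) - 1] (f '' S) := by
        rw [← hausdorffMeasure_pi_real, hcard]
    _ ≤ μH[((∑ i, dv i : ℕ) : ℝ) - 1] S := by
        simpa using hf.hausdorffMeasure_image_le hnonneg S

/-- The exponent of the box side in the direction of the `k`-th basis vector of a block. -/
def sideExponent {n : ℕ} (k : Fin n) : ℝ := if (k : ℕ) = 0 then 1 else 1 / 2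

lemma sum_sideExponent {n : ℕ} (hn : 0 < n) :
    ∑ k : Fin n, sideExponent k = ((n : ℝ) + 1) / 2 := by
  obtain ⟨n, rfl⟩ := Nat.exists_eq_succ_of_ne_zero hn.ne'
  simp [Fin.sum_univ_succ, sideExponent]
  ring

/-- The product of the sides of the box in the section, one coordinate `(j, 0)` left out. -/
lemma prod_sides_eq {m : ℕ} (dv : Fin m → ℕ) (hdv : ∀ i, 1 ≤ dv i) (v : Fin m → ℝ)
    (hv : ∀ i, 0 < v i) {δ : ℝ} (hδ : 0 < δ) (h : ℝ) (j : Fin m) :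
    ∏ q : {q : (i : Fin m) × Fin (dv i) // q ≠ ⟨j, ⟨0, hdv j⟩⟩},
        2 * (h * (δ / v q.1.1) ^ sideExponent q.1.2) =
      (2 * h) ^ (∑ i, dv i - 1) * v j *
        δ ^ ((((∑ i, dv i : ℕ) : ℝ) + m) / 2 - 1) * ∏ i, v i ^ (-(((dv i : ℝ) + 1) / 2)) := by
  have hcard : Fintype.card {q : (i : Fin m) × Fin (dv i) // q ≠ ⟨j, ⟨0, hdv j⟩⟩} =
      ∑ i, dv i - 1 := by
    rw [Fintype.card_subtype_compl, Fintype.card_subtype_eq]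
    simp
  have hall : ∏ q : (i : Fin m) × Fin (dv i), (δ / v q.1) ^ sideExponent q.2 =
      δ ^ ((((∑ i, dv i : ℕ) : ℝ) + m) / 2) * ∏ i, v i ^ (-(((dv i : ℝ) + 1) / 2)) := by
    have hexp : (((∑ i, dv i : ℕ) : ℝ) + m) / 2 = ∑ i, ((dv i : ℝ) + 1) / 2 := by
      rw [← Finset.sum_div, Finset.sum_add_distrib]
      simp
    rw [Fintype.prod_sigma, hexp, Real.rpow_sum_of_pos hδ, ← Finset.prod_mul_distrib]
    refine Finset.prod_congr rfl fun i _ => ?_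
    rw [← Real.rpow_sum_of_pos (div_pos hδ (hv i)), sum_sideExponent (hdv i),
      Real.div_rpow hδ.le (hv i).le, Real.rpow_neg (hv i).le, div_eq_mul_inv]
  have hsplit := Fintype.prod_eq_mul_prod_subtype_ne
    (fun q : (i : Fin m) × Fin (dv i) => (δ / v q.1) ^ sideExponent q.2) ⟨j, ⟨0, hdv j⟩⟩
  have hj : (δ / v j) ^ sideExponent (⟨0, hdv j⟩ : Fin (dv j)) = δ / v j := by
    simp [sideExponent]
  rw [hall] at hsplit
  simp only [hj] at hsplit
  simp_rw [← mul_assoc]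
  rw [Finset.prod_mul_distrib, Finset.prod_const, Finset.card_univ, hcard, mul_assoc, mul_assoc]
  congr 1
  rw [Real.rpow_sub_one hδ.ne', div_mul_eq_mul_div, hsplit]
  have := (hv j).ne'
  field_simp

/-- The point with block coordinates `c` in the bases `b`. -/
def ofBlockCoord {m : ℕ} (dv : Fin m → ℕ)
    (b : ∀ i, OrthonormalBasis (Fin (dv i)) ℝ (EuclideanSpace ℝ (Fin (dv i))))
    (c : (i : Fin m) × Fin (dv i) → ℝ) : EuclideanSpace ℝ ((i : Fin m) × Fin (dv i)) :=
  WithLp.toLp 2 fun p => (b p.1).repr.symm (WithLp.toLp 2 fun k => c ⟨p.1, k⟩) p.2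

lemma block_ofBlockCoord {m : ℕ} (dv : Fin m → ℕ)
    (b : ∀ i, OrthonormalBasis (Fin (dv i)) ℝ (EuclideanSpace ℝ (Fin (dv i))))
    (c : (i : Fin m) × Fin (dv i) → ℝ) (i : Fin m) :
    block dv i (ofBlockCoord dv b c) = (b i).repr.symm (WithLp.toLp 2 fun k => c ⟨i, k⟩) := rfl

lemma inner_block_ofBlockCoord {m : ℕ} (dv : Fin m → ℕ)
    (b : ∀ i, OrthonormalBasis (Fin (dv i)) ℝ (EuclideanSpace ℝ (Fin (dv i))))
    (c : (i : Fin m) × Fin (dv i) → ℝ) (q : (i : Fin m) × Fin (dv i)) :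
    ⟪b q.1 q.2, block dv q.1 (ofBlockCoord dv b c)⟫ = c q := by
  rw [block_ofBlockCoord, ← OrthonormalBasis.repr_apply_apply, LinearIsometryEquiv.apply_symm_apply]

lemma norm_block_ofBlockCoord_sq {m : ℕ} (dv : Fin m → ℕ)
    (b : ∀ i, OrthonormalBasis (Fin (dv i)) ℝ (EuclideanSpace ℝ (Fin (dv i))))
    (c : (i : Fin m) × Fin (dv i) → ℝ) (i : Fin m) :
    ‖block dv i (ofBlockCoord dv b c)‖ ^ 2 = ∑ k, c ⟨i, k⟩ ^ 2 := by
  rw [block_ofBlockCoord, LinearIsometryEquiv.norm_map, EuclideanSpace.norm_sq_eq]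
  simp

/-- A vector of length `n` with first coordinate near `1 - g` and small other coordinates has
norm at most `1 - g / 2`. -/
lemma sum_sq_le_of_near {n : ℕ} (hn : 0 < n) (c : Fin n → ℝ) {g : ℝ} (hg₀ : 0 ≤ g)
    (hg₁ : g ≤ 1) (hc₀ : |c ⟨0, hn⟩ - (1 - g)| ≤ g / 4)
    (hc : ∀ k : Fin n, (k : ℕ) ≠ 0 → n * c k ^ 2 ≤ g / 16) :
    ∑ k, c k ^ 2 ≤ (1 - g / 2) ^ 2 := by
  obtain ⟨n, rfl⟩ := Nat.exists_eq_succ_of_ne_zero hn.ne'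
  rw [Fin.sum_univ_succ]
  have htail : ∑ k : Fin n, c k.succ ^ 2 ≤ g / 16 := by
    have h : ∀ k : Fin n, c k.succ ^ 2 ≤ g / 16 / (n + 1 : ℕ) := fun k => by
      rw [le_div_iff₀ (by positivity), mul_comm]
      exact hc k.succ (by simp)
    calc ∑ k : Fin n, c k.succ ^ 2 ≤ ∑ _k : Fin n, g / 16 / (n + 1 : ℕ) :=
          Finset.sum_le_sum fun k _ => h k
      _ = n / (n + 1 : ℕ) * (g / 16) := by simp; ring
      _ ≤ 1 * (g / 16) := by
          gcongr
          rw [div_le_one (by positivity)]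
          exact_mod_cast n.le_succ
      _ = g / 16 := one_mul _
  have h0 : (⟨0, hn⟩ : Fin (n + 1)) = 0 := rfl
  rw [h0] at hc₀
  obtain ⟨h1, h2⟩ := abs_le.1 hc₀
  nlinarith [mul_nonneg (show 0 ≤ 1 - c 0 - 3 * g / 4 by linarith)
    (show 0 ≤ c 0 + 5 * g / 4 - 1 by linarith)]

/-- If a sum vanishes and all terms but one are small, then so is the remaining one. -/
lemma abs_le_card_mul_of_sum_eq_zero {m : ℕ} (D : Fin m → ℝ) (j : Fin m) {η : ℝ} (hη : 0 ≤ η)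
    (hD : ∀ i, i ≠ j → |D i| ≤ η) (hsum : ∑ i, D i = 0) (i : Fin m) : |D i| ≤ m * η := by
  have hm : (1 : ℝ) ≤ m := by exact_mod_cast Fin.pos j
  by_cases hij : i = j
  · subst hij
    rw [← Finset.add_sum_erase _ _ (Finset.mem_univ i)] at hsum
    rw [eq_neg_of_add_eq_zero_left hsum, abs_neg]
    calc |∑ k ∈ Finset.univ.erase i, D k| ≤ ∑ k ∈ Finset.univ.erase i, |D k| :=
          Finset.abs_sum_le_sum_abs _ _
      _ ≤ ∑ _k ∈ Finset.univ.erase i, η :=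
          Finset.sum_le_sum fun k hk => hD k (Finset.ne_of_mem_erase hk)
      _ ≤ ∑ _k : Fin m, η :=
          Finset.sum_le_sum_of_subset_of_nonneg (Finset.erase_subset _ _) fun _ _ _ => hη
      _ = m * η := by simp
  · exact (hD i hij).trans (le_mul_of_one_le_left hη hm)

/-- A nonnegative unit vector of `ℝ^m` has a coordinate of size at least `1 / m`. -/
lemma exists_one_le_card_mul {m : ℕ} (v : EuclideanSpace ℝ (Fin m)) (hv : ‖v‖ = 1)
    (hv₀ : ∀ i, 0 ≤ v i) : ∃ j, 1 ≤ m * v j := by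
  have hsq : ∑ i, v i ^ 2 = 1 := by
    have h := EuclideanSpace.norm_sq_eq v
    rw [hv] at h
    simpa using h.symm
  by_contra! hlt
  have hm : Nonempty (Fin m) := by
    by_contra hne
    have := not_nonempty_iff.1 hne
    simp at hsq
  have hm₀ : (1 : ℝ) ≤ m := by exact_mod_cast Fin.pos hm.some
  have h : ∑ i, m * v i ^ 2 < ∑ _i : Fin m, (1 : ℝ) :=
    Finset.sum_lt_sum_of_nonempty Finset.univ_nonempty fun i _ => by
      nlinarith [hlt i, hv₀ i, mul_nonneg (sub_nonneg.2 hm₀) (hv₀ i)]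
  rw [← Finset.mul_sum, hsq] at h
  simp at h

/-- **Inequality (3.18)**: for `w = (v_1u_1,…,v_mu_m)`, `s ∈ (max{0,s_1(v)}, ‖v‖_1)`
and `ε_i = (‖v‖_1−s)/(2m v_i)`, the `(d−1)`-dimensional Hausdorff measure of
`Z_𝕕(ε) ∩ H(w,s)` is at least `C (‖v‖_1−s)^{(d+m)/2−1} ∏_i v_i^{−(d_i+1)/2}` with a
constant `C > 0` depending only on `(d_1,…,d_m)`. -/
theorem shrunken_section_volume_lower
    (d m : ℕ) (hd : 2 ≤ d) (hm : 1 ≤ m)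
    (dv : Fin m → ℕ) (hdv : ∀ i, 1 ≤ dv i) (hsum : ∑ i, dv i = d) :
    ∃ C : ℝ, 0 < C ∧
      ∀ (w : EuclideanSpace ℝ ((i : Fin m) × Fin (dv i)))
        (u : Π i, EuclideanSpace ℝ (Fin (dv i)))
        (v : EuclideanSpace ℝ (Fin m)) (s : ℝ),
        (∀ i, ‖u i‖ = 1) → ‖v‖ = 1 → (∀ i, 0 ≤ v i) →
        (∀ p : (i : Fin m) × Fin (dv i), w p = v p.1 * u p.1 p.2) →
        max 0 ((∑ i, v i) -
            2 * Finset.univ.inf' ⟨⟨0, hm⟩, Finset.mem_univ _⟩ (fun i => v i)) < s →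
        s < ∑ i, v i →
        ENNReal.ofReal
            (C * ((∑ i, v i) - s) ^ (((d : ℝ) + m) / 2 - 1) *
              ∏ i, v i ^ (-(((dv i : ℝ) + 1) / 2)))
          ≤ μH[(d : ℝ) - 1]
              (shrunkenProdOfBalls dv (fun i => ((∑ j, v j) - s) / (2 * m * v i)) ∩
                {x | ⟪x, w⟫ = s}) := by
  have hm₁ : (1 : ℝ) ≤ m := by exact_mod_cast hm
  have hmd : (m : ℝ) ≤ d := by
    have : ∑ _i : Fin m, 1 ≤ ∑ i, dv i := Finset.sum_le_sum fun i _ => hdv i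
    rw [hsum] at this
    exact_mod_cast (by simpa using this : m ≤ d)
  have hd₁ : (1 : ℝ) ≤ d := hm₁.trans hmd
  set h : ℝ := 1 / (4 * m * d) with hh
  have hh₀ : 0 < h := by positivity
  refine ⟨(2 * h) ^ (d - 1) / m, by positivity, ?_⟩
  intro w u v s hu hv hv₀ hw hs hs₁
  obtain ⟨j, hj⟩ := exists_one_le_card_mul v hv hv₀
  set δ : ℝ := (∑ i, v i) - s with hδ
  have hδ₀ : 0 < δ := sub_pos.2 hs₁
  have hδv : ∀ i, δ < 2 * v i := fun i => by
    have h₁ := (le_max_right _ _).trans_lt hs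
    have h₂ := Finset.inf'_le (fun i => v i) (Finset.mem_univ i)
    linarith
  have hvpos : ∀ i, 0 < v i := fun i => by linarith [hδv i]
  have hδm : ∀ i, δ / (m * v i) ≤ 1 := fun i => by
    have hvi := hvpos i
    rw [div_le_one (by positivity)]
    rcases hm.eq_or_lt with rfl | hm₂
    · have hs₀ := (le_max_left _ _).trans_lt hs
      have : ∑ k, v k = v i := by rw [Fin.sum_univ_one, Subsingleton.elim i 0]
      push_cast
      linarith
    · have : (2 : ℝ) ≤ m := by exact_mod_cast hm₂
      nlinarith [hδv i]
  choose b hb using fun i => exists_orthonormalBasis_zero_eq (hdv i) (u i) (hu i)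
  have key := ofReal_prod_le_hausdorffMeasure dv b ⟨j, ⟨0, hdv j⟩⟩
    (fun q => if (q.2 : ℕ) = 0 then 1 - δ / (m * v q.1) else 0)
    (fun q => h * (δ / v q.1) ^ sideExponent q.2)
    (fun q => mul_nonneg hh₀.le (Real.rpow_nonneg (div_nonneg hδ₀.le (hv₀ _)) _))
    (shrunkenProdOfBalls dv (fun i => δ / (2 * m * v i)) ∩ {x | ⟪x, w⟫ = s}) ?_
  · rw [prod_sides_eq dv hdv v hvpos hδ₀, hsum] at key
    refine (ENNReal.ofReal_le_ofReal ?_).trans key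
    have hvj : 1 / m ≤ v j := by
      rw [div_le_iff₀ (by positivity)]
      linarith
    have hprod : 0 ≤ ∏ i, v i ^ (-(((dv i : ℝ) + 1) / 2)) :=
      Finset.prod_nonneg fun i _ => Real.rpow_nonneg (hv₀ i) _
    rw [div_eq_mul_one_div]
    gcongr
  intro c' hc'
  let c₀ : (i : Fin m) × Fin (dv i) → ℝ :=
    fun q => if hq : q ≠ ⟨j, ⟨0, hdv j⟩⟩ then c' ⟨q, hq⟩ else 0
  let t : ℝ := (s - ∑ i, v i * c₀ ⟨i, ⟨0, hdv i⟩⟩) / v j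
  let c : (i : Fin m) × Fin (dv i) → ℝ := fun q => if q = ⟨j, ⟨0, hdv j⟩⟩ then t else c₀ q
  have hc : ∀ q : {q : (i : Fin m) × Fin (dv i) // q ≠ ⟨j, ⟨0, hdv j⟩⟩}, c q = c' q := fun q => by
    simp only [c, c₀, if_neg q.2, dif_pos q.2]
  have hcsum : ∑ i, v i * c ⟨i, ⟨0, hdv i⟩⟩ = s := by
    have hci : ∀ i, v i * c ⟨i, ⟨0, hdv i⟩⟩ =
        v i * c₀ ⟨i, ⟨0, hdv i⟩⟩ + if i = j then v j * t else 0 := fun i => by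
      by_cases hij : i = j
      · subst hij
        simp [c, c₀]
      · have : (⟨i, ⟨0, hdv i⟩⟩ : (i : Fin m) × Fin (dv i)) ≠ ⟨j, ⟨0, hdv j⟩⟩ :=
          fun he => hij (congrArg Sigma.fst he)
        simp [c, this, hij]
    rw [Finset.sum_congr rfl fun i _ => hci i, Finset.sum_add_distrib,
      Finset.sum_ite_eq' Finset.univ j, if_pos (Finset.mem_univ j), mul_div_cancel₀ _ (hvpos j).ne']
    ring
  have hcbound : ∀ q : (i : Fin m) × Fin (dv i), q ≠ ⟨j, ⟨0, hdv j⟩⟩ →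
      |c q - if (q.2 : ℕ) = 0 then 1 - δ / (m * v q.1) else 0| ≤
        h * (δ / v q.1) ^ sideExponent q.2 := fun q hq => by
    rw [hc ⟨q, hq⟩]
    exact hc' ⟨q, hq⟩
  have hD : ∀ i, |v i * (c ⟨i, ⟨0, hdv i⟩⟩ - (1 - δ / (m * v i)))| ≤ m * (h * δ) := by
    refine abs_le_card_mul_of_sum_eq_zero _ j (by positivity) (fun i hij => ?_) ?_
    · have hvi := hvpos i
      have := hcbound ⟨i, ⟨0, hdv i⟩⟩ fun he => hij (congrArg Sigma.fst he)
      simp only [if_true, sideExponent, Real.rpow_one] at this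
      rw [abs_mul, abs_of_pos hvi]
      calc v i * |c ⟨i, ⟨0, hdv i⟩⟩ - (1 - δ / (m * v i))| ≤ v i * (h * (δ / v i)) := by gcongr
        _ = h * δ := by field_simp
    · have hterm : ∀ i, v i * (c ⟨i, ⟨0, hdv i⟩⟩ - (1 - δ / (m * v i))) =
          v i * c ⟨i, ⟨0, hdv i⟩⟩ - v i + δ / m := fun i => by
        have := (hvpos i).ne'
        field_simp
        ring
      rw [Finset.sum_congr rfl fun i _ => hterm i, Finset.sum_add_distrib,
        Finset.sum_sub_distrib, hcsum]
      simp only [Finset.sum_const, Finset.card_univ, Fintype.card_fin, nsmul_eq_mul]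
      rw [mul_div_cancel₀ _ (by positivity : (m : ℝ) ≠ 0), hδ]
      ring
  refine ⟨ofBlockCoord dv b c, ⟨fun i => ?_, ?_⟩, fun q => ?_⟩
  · have hvi := hvpos i
    have hε : δ / (2 * m * v i) = δ / (m * v i) / 2 := by field_simp
    rw [blockNorm_eq_norm_block]
    simp only [hε]
    refine (sq_le_sq₀ (norm_nonneg _) (by linarith [hδm i])).1 ?_
    rw [norm_block_ofBlockCoord_sq]
    refine sum_sq_le_of_near (hdv i) _ (by positivity) (hδm i) ?_ fun k hk => ?_
    · have := hD i
      rw [abs_mul, abs_of_pos hvi, mul_comm, ← le_div_iff₀ hvi] at this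
      refine this.trans ?_
      calc m * (h * δ) / v i = m / d * (δ / (m * v i) / 4) := by
            rw [hh]
            field_simp
        _ ≤ 1 * (δ / (m * v i) / 4) := by
            gcongr
            exact (div_le_one (by positivity)).2 hmd
        _ = δ / (m * v i) / 4 := one_mul _
    · have hcik := hcbound ⟨i, k⟩ fun he => hk <| by
        obtain ⟨rfl, he⟩ := Sigma.mk.inj_iff.1 he
        rw [eq_of_heq he]
      simp only [if_neg hk, sideExponent, sub_zero] at hcik
      rw [← Real.sqrt_eq_rpow] at hcik
      have hdi : (dv i : ℝ) ≤ d := by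
        rw [← hsum]
        exact_mod_cast Finset.single_le_sum (fun _ _ => Nat.zero_le _) (Finset.mem_univ i)
      calc (dv i : ℝ) * c ⟨i, k⟩ ^ 2 ≤ d * (h * √(δ / v i)) ^ 2 := by
            rw [← sq_abs (c ⟨i, k⟩)]
            gcongr
        _ = 1 / (m * d) * (δ / (m * v i) / 16) := by
            rw [mul_pow, Real.sq_sqrt (by positivity), hh]
            field_simp
            norm_num
        _ ≤ 1 * (δ / (m * v i) / 16) := by
            gcongr
            exact (div_le_one (by positivity)).2 (one_le_mul_of_one_le_of_one_le hm₁ hd₁)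
        _ = δ / (m * v i) / 16 := one_mul _
  · rw [Set.mem_ofPred_eq, inner_eq_sum_inner_block dv _ w u v hw, ← hcsum]
    refine Finset.sum_congr rfl fun i _ => ?_
    rw [← hb i, inner_block_ofBlockCoord dv b c ⟨i, ⟨0, hdv i⟩⟩]
  · rw [inner_block_ofBlockCoord dv b c q.1, hc]
end
end
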